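/- Let n ≥ 3 be an integer, let m > 0 with m ≠ 1, let λ > 0 and β, μ ∈ ℝ, let I ⊆ ℝ be an open interval with 0 ∈ I, and let φ, f : I → ℝ be smooth with φ(t) > 0 for all t ∈ I and f non-constant. Suppose (φ, f) satisfies the weighted Einstein ODE system for (n, m, λ, μ, β) on I and in addition φ''(t) = −2λ·φ(t) for all t ∈ I. Then there exist constants c₁ > 0, c₂ ∈ ℝ, c₃ > 0, c₄ ≠ 0 such that for all t ∈ I: φ(t) = c₁·cos(√(2λ)·t) + c₂·sin(√(2λ)·t) and f(t) = −m·log( c₃ + c₂c₄·(cos(√(2λ)·t) − 1) − c₁c₄·sin(√(2λ)·t) ), and moreover β = 2(c₁² + c₂²)(n−2)λ and μ = 2(c₁²c₄² + 2c₂c₃c₄ − c₃²)λ. -/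

import Mathlib

/-- The weighted Schouten scalar `J` of the warped-product SMMS, defined by
`2(n+m-1) J = (n-1)(β-(n-2)(φ')²)/φ² + 2(n-1)(φ'f'-φ'')/φ + 2f'' - ((m+1)/m)(f')² + m(m-1)μ e^{2f/m}`. -/
noncomputable def weightedJ (n : ℕ) (m μ β : ℝ) (φ f : ℝ → ℝ) (t : ℝ) : ℝ :=
  (1 / (2 * ((n : ℝ) + m - 1))) *
    (((n : ℝ) - 1) * (β - ((n : ℝ) - 2) * (deriv φ t) ^ 2) / (φ t) ^ 2
      + 2 * ((n : ℝ) - 1) * (deriv φ t * deriv f t - deriv (deriv φ) t) / φ t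
      + 2 * deriv (deriv f) t - ((m + 1) / m) * (deriv f t) ^ 2
      + m * (m - 1) * μ * Real.exp (2 * f t / m))

/-- Equation (E1): `β - φ''φ - (n-2)(φ')² - 2(n-1)λφ² = 0`. -/
def wE1 (n : ℕ) (lam β : ℝ) (φ : ℝ → ℝ) (t : ℝ) : Prop :=
  β - deriv (deriv φ) t * φ t - ((n : ℝ) - 2) * (deriv φ t) ^ 2
    - 2 * ((n : ℝ) - 1) * lam * (φ t) ^ 2 = 0

/-- Equation (E2): `f'' - (n-1)φ''/φ - (1/m)(f')² - φ'f'/φ - 2(n-1)λ = 0`. -/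
def wE2 (n : ℕ) (m lam : ℝ) (φ f : ℝ → ℝ) (t : ℝ) : Prop :=
  deriv (deriv f) t - ((n : ℝ) - 1) * deriv (deriv φ) t / φ t
    - (1 / m) * (deriv f t) ^ 2 - deriv φ t * deriv f t / φ t
    - 2 * ((n : ℝ) - 1) * lam = 0

/-- Equation (E3): `φ'f'/φ + (n-m)λ - J = 0`. -/
def wE3 (n : ℕ) (m lam μ β : ℝ) (φ f : ℝ → ℝ) (t : ℝ) : Prop :=
  deriv φ t * deriv f t / φ t + ((n : ℝ) - m) * lam - weightedJ n m μ β φ f t = 0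

/-- The weighted Einstein ODE system of Lemma 3.5 of the paper, characterizing
warped-product SMMSs `I ×_φ N` with Einstein fiber that are weighted Einstein
with weighted harmonic Weyl tensor. -/
def WeightedEinsteinODE (n : ℕ) (m lam μ β : ℝ) (I : Set ℝ) (φ f : ℝ → ℝ) : Prop :=
  ∀ t ∈ I, wE1 n lam β φ t ∧ wE2 n m lam φ f t ∧ wE3 n m lam μ β φ f t

theorem const_of_hasDerivAt_zero (I : Set ℝ) (hIconn : I.OrdConnected) (hI0 : (0 : ℝ) ∈ I)
    (g : ℝ → ℝ) (hg : ∀ t ∈ I, HasDerivAt g 0 t) : ∀ t ∈ I, g t = g 0 := by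
  intro t ht
  have hc : Convex ℝ I := hIconn.convex
  have := hc.norm_image_sub_le_of_norm_hasDerivWithin_le (f := g) (f' := fun _ => 0) (C := 0)
    (fun x hx => (hg x hx).hasDerivWithinAt) (fun x _ => by simp) hI0 ht
  simp only [zero_mul] at this
  exact sub_eq_zero.mp (norm_le_zero_iff.mp this)

/-- Case (1) (λ > 0) of Theorem 4.1 of the paper. -/
theorem stmt_8 (n : ℕ) (hn : 3 ≤ n) (m : ℝ) (hm : 0 < m) (hm1 : m ≠ 1)
    (lam : ℝ) (hlam : 0 < lam) (β μ : ℝ)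
    (I : Set ℝ) (hIopen : IsOpen I) (hIconn : I.OrdConnected) (hI0 : (0 : ℝ) ∈ I)
    (φ f : ℝ → ℝ) (hφ : ContDiffOn ℝ (⊤ : ℕ∞) φ I) (hf : ContDiffOn ℝ (⊤ : ℕ∞) f I)
    (hφpos : ∀ t ∈ I, 0 < φ t)
    (hfnc : ¬ ∃ c : ℝ, ∀ t ∈ I, f t = c)
    (hsys : WeightedEinsteinODE n m lam μ β I φ f)
    (hEin : ∀ t ∈ I, deriv (deriv φ) t = -2 * lam * φ t) :
    ∃ c₁ c₂ c₃ c₄ : ℝ, 0 < c₁ ∧ 0 < c₃ ∧ c₄ ≠ 0 ∧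
      (∀ t ∈ I,
        φ t = c₁ * Real.cos (Real.sqrt (2 * lam) * t)
            + c₂ * Real.sin (Real.sqrt (2 * lam) * t) ∧
        f t = -m * Real.log (c₃ + c₂ * c₄ * (Real.cos (Real.sqrt (2 * lam) * t) - 1)
            - c₁ * c₄ * Real.sin (Real.sqrt (2 * lam) * t))) ∧
      β = 2 * (c₁ ^ 2 + c₂ ^ 2) * ((n : ℝ) - 2) * lam ∧
      μ = 2 * (c₁ ^ 2 * c₄ ^ 2 + 2 * c₂ * c₃ * c₄ - c₃ ^ 2) * lam := by
  obtain ⟨w, hwdef⟩ : ∃ w, w = Real.sqrt (2 * lam) := ⟨_, rfl⟩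
  have hw : 0 < w := by rw [hwdef]; exact Real.sqrt_pos.mpr (by linarith)
  have hw2 : w ^ 2 = 2 * lam := by rw [hwdef]; exact Real.sq_sqrt (by linarith)
  rw [← hwdef]
  have hw0 : w ≠ 0 := hw.ne'
  have hm0 : m ≠ 0 := hm.ne'
  have key : ∀ g : ℝ → ℝ, ContDiffOn ℝ (⊤ : ℕ∞) g I →
      ∀ t ∈ I, HasDerivAt g (deriv g t) t ∧ HasDerivAt (deriv g) (deriv (deriv g) t) t := by
    intro g hg t ht
    have hmem := hIopen.mem_nhds ht
    constructor
    · exact ((hg.differentiableOn (by simp)).differentiableAt hmem).hasDerivAt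
    · have h2 : ContDiffOn ℝ 1 (deriv g) I :=
        hg.deriv_of_isOpen hIopen (by norm_cast)
      exact ((h2.differentiableOn (by simp)).differentiableAt hmem).hasDerivAt
  have hφd := fun t ht => (key φ hφ t ht).1
  have hφdd : ∀ t ∈ I, HasDerivAt (deriv φ) (-w ^ 2 * φ t) t := fun t ht => by
    have := (key φ hφ t ht).2
    rw [hEin t ht] at this
    convert this using 1
    rw [hw2]; ring
  have hfd := fun t ht => (key f hf t ht).1
  have hfdd := fun t ht => (key f hf t ht).2
  have hlin : ∀ t : ℝ, HasDerivAt (fun s : ℝ => w * s) w t := fun t => by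
    simpa using (hasDerivAt_id t).const_mul w
  have hcos : ∀ t, HasDerivAt (fun s => Real.cos (w * s)) (-Real.sin (w * t) * w) t :=
    fun t => (hlin t).cos
  have hsin : ∀ t, HasDerivAt (fun s => Real.sin (w * s)) (Real.cos (w * t) * w) t :=
    fun t => (hlin t).sin
  have hg1 := const_of_hasDerivAt_zero I hIconn hI0
    (fun s => φ s * Real.cos (w * s) - deriv φ s / w * Real.sin (w * s)) (fun t ht => by
      refine HasDerivAt.congr_deriv (((hφd t ht).mul (hcos t)).sub (((hφdd t ht).div_const w).mul (hsin t))) ?_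
      field_simp; ring)
  have hg2 := const_of_hasDerivAt_zero I hIconn hI0
    (fun s => φ s * Real.sin (w * s) + deriv φ s / w * Real.cos (w * s)) (fun t ht => by
      refine HasDerivAt.congr_deriv (((hφd t ht).mul (hsin t)).add (((hφdd t ht).div_const w).mul (hcos t))) ?_
      field_simp; ring)
  simp only [mul_zero, Real.cos_zero, Real.sin_zero, mul_one, sub_zero, zero_add] at hg1 hg2
  obtain ⟨c₂, hc₂⟩ : ∃ c, c = deriv φ 0 / w := ⟨_, rfl⟩
  rw [← hc₂] at hg2
  have hφform : ∀ t ∈ I, φ t = φ 0 * Real.cos (w * t) + c₂ * Real.sin (w * t) := by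
    intro t ht
    rw [← hg1 t ht, ← hg2 t ht]
    linear_combination (-φ t) * Real.sin_sq_add_cos_sq (w * t)
  -- u = exp (-f/m)
  obtain ⟨u, hu⟩ : ∃ u : ℝ → ℝ, u = fun s => Real.exp (-f s / m) := ⟨_, rfl⟩
  have hupos : ∀ t, 0 < u t := fun t => by rw [hu]; exact Real.exp_pos _
  have hud : ∀ t ∈ I, HasDerivAt u (u t * (-deriv f t / m)) t := fun t ht => by
    rw [hu]; exact (((hfd t ht).neg).div_const m).exp
  have hE2 : ∀ t ∈ I, deriv (deriv f) t = (deriv f t) ^ 2 / m + deriv φ t * deriv f t / φ t := by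
    intro t ht
    have h := (hsys t ht).2.1
    have hp := (hφpos t ht).ne'
    unfold wE2 at h
    rw [hEin t ht] at h
    have e : ((n : ℝ) - 1) * (-2 * lam * φ t) / φ t = ((n : ℝ) - 1) * (-2 * lam) := by
      field_simp
    rw [e] at h
    linear_combination h
  have hq := const_of_hasDerivAt_zero I hIconn hI0
    (fun s => u s * (-deriv f s / m) / φ s) (fun t ht => by
      have hp := (hφpos t ht).ne'
      refine HasDerivAt.congr_deriv (((hud t ht).mul ((hfdd t ht).neg.div_const m)).div (hφd t ht) hp) ?_
      try simp only [Pi.mul_apply, Pi.neg_apply]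
      rw [hE2 t ht]
      field_simp; ring)
  obtain ⟨k, hk⟩ : ∃ k, k = u 0 * (-deriv f 0 / m) / φ 0 := ⟨_, rfl⟩
  simp only [← hk] at hq
  have hud' : ∀ t ∈ I, HasDerivAt u (k * φ t) t := fun t ht => by
    have h := hud t ht
    have hp := (hφpos t ht).ne'
    convert h using 1
    rw [← hq t ht]; field_simp
  have huf := const_of_hasDerivAt_zero I hIconn hI0
    (fun s => u s - (k / w * (φ 0 * Real.sin (w * s) - c₂ * Real.cos (w * s)))) (fun t ht => by
      refine HasDerivAt.congr_deriv ((hud' t ht).sub ((((hsin t).const_mul (φ 0)).sub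
        ((hcos t).const_mul c₂)).const_mul (k / w))) ?_
      rw [hφform t ht]
      field_simp; ring)
  simp only [mul_zero, Real.cos_zero, Real.sin_zero, mul_one, zero_sub] at huf
  have hlog : ∀ t, f t = -m * Real.log (u t) := fun t => by
    rw [hu]; simp only [Real.log_exp]; field_simp
  have hp0 := hφpos 0 hI0
  have hp0' := hp0.ne'
  have hf0 : deriv f 0 = -m * k * φ 0 / u 0 := by
    have := (hupos 0).ne'
    rw [hk]; field_simp
  have hφ0 : deriv φ 0 = c₂ * w := by rw [hc₂]; field_simp
  have hl : lam = w ^ 2 / 2 := by linarith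
  have hβ : β = ((n : ℝ) - 2) * w ^ 2 * (φ 0 ^ 2 + c₂ ^ 2) := by
    have h := (hsys 0 hI0).1
    unfold wE1 at h
    rw [hEin 0 hI0, hφ0, hl] at h
    linear_combination h
  refine ⟨φ 0, c₂, u 0, -k / w, hp0, hupos 0, ?_, ?_, ?_, ?_⟩
  · intro h
    have hk0 : k = 0 := by
      field_simp at h; simpa using h
    apply hfnc
    refine ⟨-m * Real.log (u 0), fun t ht => ?_⟩
    have := huf t ht
    rw [hk0] at this
    rw [hlog t]
    congr 2
    simpa using this
  · intro t ht
    refine ⟨hφform t ht, ?_⟩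
    rw [hlog t]
    congr 2
    linear_combination huf t ht
  · rw [hβ, hl]; ring
  · have h := (hsys 0 hI0).2.2
    have hu0 := (hupos 0).ne'
    have hexp : Real.exp (2 * f 0 / m) = 1 / (u 0) ^ 2 := by
      rw [hu, eq_div_iff (by positivity), ← Real.exp_nat_mul, ← Real.exp_add]
      convert Real.exp_zero using 2
      push_cast; field_simp; ring
    unfold wE3 weightedJ at h
    rw [hE2 0 hI0, hEin 0 hI0, hexp, hf0, hφ0, hβ, hl] at h
    have hn' : (3 : ℝ) ≤ n := by exact_mod_cast hn
    have hN : (n : ℝ) + m - 1 ≠ 0 := by linarith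
    have hm1' : m - 1 ≠ 0 := sub_ne_zero.mpr hm1
    rw [hl]
    field_simp at h ⊢
    have hmm : m * (m - 1) ≠ 0 := mul_ne_zero hm0 hm1'
    apply mul_left_cancel₀ (mul_ne_zero hmm (pow_ne_zero 2 hp0'))
    linear_combination -h
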